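/- σ-orbit recursion: Let σ ∈ (ℤ/mℤ)^r, let σ̂ be the weakly decreasing rearrangement of σ (comparing representatives in {1,…,m}) and let w ∈ S_r be the minimal-length permutation with σ = wσ̂ (i.e. σ_i = σ̂_{w^{−1}(i)}). Then for every reduced expression w = s_{i_1}s_{i_2}⋯s_{i_k}, one has the identity in the rational function field ℂ(z_1,…,z_r): Z(𝔖^m_{μ,σ}) = α̃_w(σ̂) · T_{i_1}T_{i_2}⋯T_{i_k} · Z(𝔖^m_{μ,σ̂}), where the partition functions are regarded as polynomials in z_1, …, z_r. -/

import Mathlib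

noncomputable section

/-- A spin: either `+` (`none`) or a color `c_i` represented by the residue class
`i mod m` of its index `i ∈ {1, …, m}` (`some` of that class). -/
abbrev Spin (m : ℕ) := Option (ZMod m)

/-- The representative in `{1, …, m}` of a residue class mod `m`. -/
def rep (m : ℕ) (x : ZMod m) : ℕ := (x - 1).val + 1

/-- Boltzmann weight of a T-vertex with column color (class) `j` and row parameter `z`,
on the spins `(a, b, c, d)` of its (left, top, right, bottom) edges; inadmissible
configurations get weight `0`. -/
def wt (m : ℕ) (q Φ : ℂ) (α : ZMod m → ZMod m → ℂ) (j : ZMod m) (z : ℂ) :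
    Spin m → Spin m → Spin m → Spin m → ℂ
  | some a, some b, some c, some d =>
      if b = j ∧ d = j ∧ c = a then (if a = j then Φ * q * z else Φ * α (-a) (-j)) else 0
  | none, some b, none, some d => if b = j ∧ d = j then -Φ / q else 0
  | some a, none, some c, none => if c = a then (if a = j then z else 1) else 0
  | some a, none, none, some d => if a = j ∧ d = j then -(Φ / q) * (1 - q ^ 2) * z else 0
  | none, some b, some c, none => if b = j ∧ c = j then 1 else 0
  | none, none, none, none => 1
  | _, _, _, _ => 0

/-- The admissible configurations `(a, b, c, d)` = (left, top, right, bottom) of a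
T-vertex with column color (class) `j`. -/
def Adm (m : ℕ) (j : ZMod m) (a b c d : Spin m) : Prop :=
  (a = none ∧ b = none ∧ c = none ∧ d = none) ∨
  (∃ i : ZMod m, a = some i ∧ b = some j ∧ c = some i ∧ d = some j) ∨
  (a = none ∧ b = some j ∧ c = none ∧ d = some j) ∨
  (∃ i : ZMod m, a = some i ∧ b = none ∧ c = some i ∧ d = none) ∨
  (a = some j ∧ b = none ∧ c = none ∧ d = some j) ∨
  (a = none ∧ b = some j ∧ c = some j ∧ d = none)

/-- A spin configuration of the `r × N` grid: `s.1 i p` is the spin of the horizontal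
edge of row `i` which is the right edge of column `p` (so `s.1 i 0` is the right
boundary edge of row `i` and `s.1 i (Fin.last N)` the left boundary edge), and
`s.2 i k` records whether the vertical edge of column `k` on row-boundary `i` is
occupied (columns are numbered `0, …, N − 1` from the right). -/
abbrev GState (m r N : ℕ) := (Fin r → Fin (N + 1) → Spin m) × (Fin (r + 1) → Fin N → Bool)

/-- The column color (class) of column number `k`: `j(k) ≡ −k (mod m)`. -/
def colC (m k : ℕ) : ZMod m := -(k : ZMod m)

/-- The spin of the vertical edge of column `k` on row-boundary `i`. -/
def vspin {m r N : ℕ} (s : GState m r N) (i : Fin (r + 1)) (k : Fin N) : Spin m :=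
  if s.2 i k then some (colC m k) else none

/-- `s` is an admissible state of the system `𝔖^m_{μ,σ}`: the left and bottom boundary
edges carry `+`, the top boundary vertical edge in column `k` is occupied iff `k` is a
part of `μ`, the right boundary edge of row `i` carries the color `c_{σ_i}`, and every
vertex is in an admissible configuration. -/
def IsState {m r N : ℕ} (μ : Fin r → ℕ) (σ : Fin r → ZMod m) (s : GState m r N) : Prop :=
  (∀ i, s.1 i (Fin.last N) = none) ∧
  (∀ i, s.1 i 0 = some (σ i)) ∧
  (∀ k : Fin N, (s.2 0 k = true ↔ ∃ i, μ i = (k : ℕ))) ∧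
  (∀ k, s.2 (Fin.last r) k = false) ∧
  (∀ (i : Fin r) (k : Fin N),
    Adm m (colC m k) (s.1 i k.succ) (vspin s i.castSucc k) (s.1 i k.castSucc)
      (vspin s i.succ k))

/-- The Boltzmann weight of a state: the product of the weights of all its vertices. -/
def swt {m r N : ℕ} (q Φ : ℂ) (α : ZMod m → ZMod m → ℂ) (z : Fin r → ℂ)
    (s : GState m r N) : ℂ :=
  ∏ i : Fin r, ∏ k : Fin N,
    wt m q Φ α (colC m k) (z i) (s.1 i k.succ) (vspin s i.castSucc k) (s.1 i k.castSucc)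
      (vspin s i.succ k)

open Classical in
/-- The partition function `Z(𝔖^m_{μ,σ})(z_1, …, z_r)`: the sum of the weights of all
admissible states of the system `𝔖^m_{μ,σ}`. -/
def Z (m : ℕ) [NeZero m] (r N : ℕ) (q Φ : ℂ) (α : ZMod m → ZMod m → ℂ)
    (μ : Fin r → ℕ) (σ : Fin r → ZMod m) (z : Fin r → ℂ) : ℂ :=
  ∑ s : GState m r N, if IsState μ σ s then swt q Φ α z s else 0

/-- Indices of adjacent transpositions `s_i` of `S_r` (for `1 ≤ i ≤ r − 1`, stored
0-indexed as `i` with `i + 1 < r`). -/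
abbrev AIdx (r : ℕ) := {i : ℕ // i + 1 < r}

def idx0 {r : ℕ} (i : AIdx r) : Fin r := ⟨i.1, Nat.lt_of_succ_lt i.2⟩

def idx1 {r : ℕ} (i : AIdx r) : Fin r := ⟨i.1 + 1, i.2⟩

/-- The simple reflection `s_i ∈ S_r`, the transposition of `i` and `i + 1`. -/
def sw {r : ℕ} (i : AIdx r) : Equiv.Perm (Fin r) := Equiv.swap (idx0 i) (idx1 i)

/-- The action of `S_r` on `r`-tuples by permuting components: `(u • σ)_i = σ_{u⁻¹(i)}`. -/
def pact {r : ℕ} {X : Type*} (u : Equiv.Perm (Fin r)) (σ : Fin r → X) : Fin r → X :=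
  fun k => σ (u⁻¹ k)

/-- The product `s_{i_1} s_{i_2} ⋯ s_{i_k}` of the word `L = [i_1, …, i_k]`. -/
def wordProd {r : ℕ} (L : List (AIdx r)) : Equiv.Perm (Fin r) := (L.map sw).prod

/-- The length `ℓ(w)` of `w ∈ S_r`: the number of inversions. -/
def invCount {r : ℕ} (w : Equiv.Perm (Fin r)) : ℕ :=
  (Finset.univ.filter fun p : Fin r × Fin r => p.1 < p.2 ∧ w p.2 < w p.1).card

/-- `ε(σ, i, j) = 1` if `σ_i > σ_j`, `0` if `σ_i = σ_j`, `−1` if `σ_i < σ_j`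
(comparing representatives in `{1, …, m}`); used for the adjacent pair `j = i + 1`. -/
def eps (m : ℕ) {r : ℕ} (σ : Fin r → ZMod m) (i j : Fin r) : ℤ :=
  if rep m (σ j) < rep m (σ i) then 1 else if rep m (σ i) = rep m (σ j) then 0 else -1

/-- The normalized constant `α̃_i(σ) = α_{−σ_{i+1}, −σ_i} · q^{ε(σ,i)}`, evaluated at the
adjacent pair `(i, j) = (i, i + 1)`. -/
def alphaT (m : ℕ) (q : ℂ) (α : ZMod m → ZMod m → ℂ) {r : ℕ}
    (σ : Fin r → ZMod m) (i j : Fin r) : ℂ :=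
  α (-(σ j)) (-(σ i)) * q ^ eps m σ i j

/-- For a word `L = [i_1, …, i_k]`, the product
`α̃_{i_1}(s_{i_2}⋯s_{i_k}σ) · α̃_{i_2}(s_{i_3}⋯s_{i_k}σ) ⋯ α̃_{i_k}(σ)`. -/
def alphaTWord (m : ℕ) (q : ℂ) (α : ZMod m → ZMod m → ℂ) {r : ℕ} :
    List (AIdx r) → (Fin r → ZMod m) → ℂ
  | [], _ => 1
  | i :: L, σ => alphaT m q α (pact (wordProd L) σ) (idx0 i) (idx1 i) * alphaTWord m q α L σ

/-- The Demazure–Whittaker operator `T_i` acting on functions of `z = (z_1, …, z_r)`: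
`(T_i f)(z) = ((z_i − q⁻²z_{i+1})/(z_{i+1} − z_i)) f(s_i z)
            + ((q⁻² − 1) z_{i+1}/(z_{i+1} − z_i)) f(z)`. -/
def DemT (q : ℂ) {r : ℕ} (i : AIdx r) (f : (Fin r → ℂ) → ℂ) : (Fin r → ℂ) → ℂ := fun z =>
  (z (idx0 i) - (q ^ 2)⁻¹ * z (idx1 i)) / (z (idx1 i) - z (idx0 i)) * f (z ∘ sw i) +
    ((q ^ 2)⁻¹ - 1) * z (idx1 i) / (z (idx1 i) - z (idx0 i)) * f z

/-- The inverse operator `T_i⁻¹`: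
`(T_i⁻¹ f)(z) = ((z_i − q⁻²z_{i+1})/(q⁻²(z_{i+1} − z_i))) f(s_i z)
             + ((q⁻² − 1) z_i/(q⁻²(z_{i+1} − z_i))) f(z)`. -/
def DemTInv (q : ℂ) {r : ℕ} (i : AIdx r) (f : (Fin r → ℂ) → ℂ) : (Fin r → ℂ) → ℂ := fun z =>
  (z (idx0 i) - (q ^ 2)⁻¹ * z (idx1 i)) / ((q ^ 2)⁻¹ * (z (idx1 i) - z (idx0 i))) *
      f (z ∘ sw i) +
    ((q ^ 2)⁻¹ - 1) * z (idx0 i) / ((q ^ 2)⁻¹ * (z (idx1 i) - z (idx0 i))) * f z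

/-- `DemTWord q [i_1, …, i_k] f = T_{i_1} T_{i_2} ⋯ T_{i_k} f`. -/
def DemTWord (q : ℂ) {r : ℕ} : List (AIdx r) → ((Fin r → ℂ) → ℂ) → (Fin r → ℂ) → ℂ
  | [], f => f
  | i :: L, f => DemT q i (DemTWord q L f)

/-- `DemTWordInv q [j_1, …, j_t] f = T_{j_t}⁻¹ ⋯ T_{j_1}⁻¹ f`, the inverse of
`T_{w'} = T_{j_1} ⋯ T_{j_t}`. -/
def DemTWordInv (q : ℂ) {r : ℕ} : List (AIdx r) → ((Fin r → ℂ) → ℂ) → (Fin r → ℂ) → ℂ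
  | [], f => f
  | i :: L, f => DemTWordInv q L (DemTInv q i f)

section RowTransfer

variable {m : ℕ}

/-- The spin of a vertical edge in a column of color `j`. -/
def edgeSpin (j : ZMod m) (b : Bool) : Spin m := if b then some j else none

lemma wt_eq_zero_of_not_adm {q Φ : ℂ} {α : ZMod m → ZMod m → ℂ} {j : ZMod m} {z : ℂ}
    {a b c d : Spin m} (h : ¬ Adm m j a b c d) : wt m q Φ α j z a b c d = 0 := by
  rcases a with _ | a <;> rcases b with _ | b <;> rcases c with _ | c <;> rcases d with _ | d <;>
    simp [Adm, wt] at h ⊢ <;> grind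

/-- Weight of a vertex on an unoccupied column, passing spin `c`. -/
def wtEmpty (j : ZMod m) (z : ℂ) : Spin m → ℂ
  | none => 1
  | some a => if a = j then z else 1

/-- Weight of a vertex on an occupied column, passing spin `c`. -/
def wtFull (q Φ : ℂ) (α : ZMod m → ZMod m → ℂ) (j : ZMod m) (z : ℂ) : Spin m → ℂ
  | none => -Φ / q
  | some a => if a = j then Φ * q * z else Φ * α (-a) (-j)

variable [NeZero m] (q Φ : ℂ) (α : ZMod m → ZMod m → ℂ)

/-- The action of one vertex on functions of the spin of its left edge. -/
def rowStep (j : ZMod m) (z : ℂ) (t b : Bool) (f : Spin m → ℂ) (c : Spin m) : ℂ :=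
  ∑ a, f a * wt m q Φ α j z a (edgeSpin j t) c (edgeSpin j b)

lemma rowStep_ff (j : ZMod m) (z : ℂ) (f : Spin m → ℂ) (c : Spin m) :
    rowStep q Φ α j z false false f c = f c * wtEmpty j z c := by
  rw [rowStep, Fintype.sum_eq_single c]
  · rcases c with _ | c <;> simp [edgeSpin, wt, wtEmpty]
  · intro a ha
    rcases c with _ | c <;> rcases a with _ | a <;> simp [edgeSpin, wt] at ha ⊢
    grind

lemma rowStep_tt (j : ZMod m) (z : ℂ) (f : Spin m → ℂ) (c : Spin m) :
    rowStep q Φ α j z true true f c = f c * wtFull q Φ α j z c := by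
  rw [rowStep, Fintype.sum_eq_single c]
  · rcases c with _ | c <;> simp [edgeSpin, wt, wtFull]
  · intro a ha
    rcases c with _ | c <;> rcases a with _ | a <;> simp [edgeSpin, wt] at ha ⊢
    grind

lemma rowStep_ft (j : ZMod m) (z : ℂ) (f : Spin m → ℂ) (c : Spin m) :
    rowStep q Φ α j z false true f c =
      if c = none then f (some j) * (-(Φ / q) * (1 - q ^ 2) * z) else 0 := by
  rw [rowStep, Fintype.sum_eq_single (some j)]
  · rcases c with _ | c <;> simp [edgeSpin, wt]
  · intro a ha
    rcases c with _ | c <;> rcases a with _ | a <;> simp [edgeSpin, wt] at ha ⊢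
    grind

lemma rowStep_tf (j : ZMod m) (z : ℂ) (f : Spin m → ℂ) (c : Spin m) :
    rowStep q Φ α j z true false f c = if c = some j then f none else 0 := by
  rw [rowStep, Fintype.sum_eq_single none]
  · rcases c with _ | c <;> simp [edgeSpin, wt]
  · intro a ha
    rcases c with _ | c <;> rcases a with _ | a <;> simp [edgeSpin, wt] at ha ⊢

/-- The action of a column of two vertices on functions of the spins of the left edges. -/
def colStep (j : ZMod m) (z₁ z₂ : ℂ) (t b : Bool) (V : Spin m → Spin m → ℂ)
    (c d : Spin m) : ℂ :=
  ∑ x, rowStep q Φ α j z₂ x b (fun d' => rowStep q Φ α j z₁ t x (fun c' => V c' d') c) d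

/-- The partition function of one row of `N` columns numbered `p, …, p + N - 1`, with left
boundary spin `+` and right boundary spin `c`. -/
def rowZ (z : ℂ) : (N p : ℕ) → (Fin N → Bool) → (Fin N → Bool) → Spin m → ℂ
  | 0, _, _, _, c => if c = none then 1 else 0
  | N + 1, p, T, B, c =>
      rowStep q Φ α (colC m p) z (T 0) (B 0) (rowZ z N (p + 1) (Fin.tail T) (Fin.tail B)) c

/-- The partition function of two adjacent rows with spectral parameters `z₁` and `z₂`. -/
def pairZ (z₁ z₂ : ℂ) (N p : ℕ) (T B : Fin N → Bool) (c d : Spin m) : ℂ :=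
  ∑ x : Fin N → Bool, rowZ q Φ α z₁ N p T x c * rowZ q Φ α z₂ N p x B d

lemma sum_fin_cons {X : Type*} [Fintype X] {n : ℕ} (f : (Fin (n + 1) → X) → ℂ) :
    ∑ v, f v = ∑ x, ∑ u : Fin n → X, f (Fin.cons x u) := by
  rw [← (Fin.consEquiv (fun _ : Fin (n + 1) => X)).sum_comp, Fintype.sum_prod_type]
  rfl

lemma rowZ_eq_sum (z : ℂ) (N p : ℕ) (T B : Fin N → Bool) (c : Spin m) :
    rowZ q Φ α z N p T B c = ∑ h : Fin (N + 1) → Spin m,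
      if h (Fin.last N) = none ∧ h 0 = c then
        ∏ k : Fin N, wt m q Φ α (colC m (p + k)) z (h k.succ) (edgeSpin (colC m (p + k)) (T k))
          (h k.castSucc) (edgeSpin (colC m (p + k)) (B k)) else 0 := by
  induction N generalizing p c with
  | zero =>
    rw [sum_fin_cons]
    simp only [rowZ, Finset.univ_unique, Finset.sum_singleton]
    rw [Fintype.sum_eq_single c]
    · simp
    · intro x hx
      simp [hx]
  | succ N ih =>
    rw [sum_fin_cons, Fintype.sum_eq_single c]
    · rw [rowZ, rowStep]
      simp only [ih, Finset.sum_mul]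
      rw [Finset.sum_comm]
      refine Finset.sum_congr rfl fun h _ => ?_
      rw [Fintype.sum_eq_single (h 0)]
      · rw [Fin.prod_univ_succ, ← Fin.succ_last]
        simp only [Fin.cons_succ, Fin.cons_zero, Fin.castSucc_zero, Fin.val_zero, add_zero,
          Fin.val_succ, Fin.tail, and_true, ite_mul, zero_mul]
        refine if_congr Iff.rfl ?_ rfl
        rw [mul_comm]
        congr 1
        refine Finset.prod_congr rfl fun k _ => ?_
        rw [← Fin.succ_castSucc, Fin.cons_succ, show p + 1 + (k : ℕ) = p + (k + 1) by ring]
      · intro a ha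
        simp [ha.symm]
    · intro x hx
      simp [hx]

lemma pairZ_succ (z₁ z₂ : ℂ) (N p : ℕ) (T B : Fin (N + 1) → Bool) (c d : Spin m) :
    pairZ q Φ α z₁ z₂ (N + 1) p T B c d =
      colStep q Φ α (colC m p) z₁ z₂ (T 0) (B 0)
        (pairZ q Φ α z₁ z₂ N (p + 1) (Fin.tail T) (Fin.tail B)) c d := by
  rw [pairZ, sum_fin_cons, colStep]
  refine Finset.sum_congr rfl fun x _ => ?_
  simp only [rowZ, rowStep, pairZ, Finset.sum_mul, Finset.mul_sum, Fin.cons_zero, Fin.tail_cons]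
  rw [Finset.sum_comm]
  refine Finset.sum_congr rfl fun a _ => ?_
  rw [Finset.sum_comm]
  refine Finset.sum_congr rfl fun b _ => ?_
  refine Finset.sum_congr rfl fun u _ => ?_
  ring

end RowTransfer

section Exchange

variable {m : ℕ}

/-- The exchange relations expressing `V` on transposed spins through `V` and the function
`W` obtained from it by interchanging the spectral parameters. -/
structure HalfExchange (q Φ : ℂ) (α : ZMod m → ZMod m → ℂ) (gt : ZMod m → ZMod m → Prop)
    (z₁ z₂ : ℂ) (V W : Spin m → Spin m → ℂ) : Prop where
  plus : ∀ a, V none (some a) = Φ / (q * (z₂ - z₁)) *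
    ((q ^ 2 * z₁ - z₂) * W (some a) none + (1 - q ^ 2) * z₁ * V (some a) none)
  color : ∀ a b, gt a b → V (some b) (some a) = α (-b) (-a) / (q * (z₂ - z₁)) *
    ((q ^ 2 * z₁ - z₂) * W (some a) (some b) + (1 - q ^ 2) * z₂ * V (some a) (some b))

/-- All the relations between a two-row partition function `V` and the one with interchanged
spectral parameters `W`. -/
structure Exchange (q Φ : ℂ) (α : ZMod m → ZMod m → ℂ) (gt : ZMod m → ZMod m → Prop)
    (z₁ z₂ : ℂ) (V W : Spin m → Spin m → ℂ) : Prop where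
  left : HalfExchange q Φ α gt z₁ z₂ V W
  right : HalfExchange q Φ α gt z₂ z₁ W V
  plus_plus : V none none = W none none
  diag : ∀ a, ∃ u, V (some a) (some a) = (q ^ 2 * z₁ - z₂) * u ∧
    W (some a) (some a) = (q ^ 2 * z₂ - z₁) * u

variable {q Φ : ℂ} {α : ZMod m → ZMod m → ℂ} {gt gt' : ZMod m → ZMod m → Prop}
  {z₁ z₂ : ℂ} {V W : Spin m → Spin m → ℂ}

lemma Exchange.symm (h : Exchange q Φ α gt z₁ z₂ V W) : Exchange q Φ α gt z₂ z₁ W V :=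
  ⟨h.right, h.left, h.plus_plus.symm, fun a => (h.diag a).imp fun _ hu => hu.symm⟩

variable [NeZero m]

lemma colStep_eq (j : ZMod m) (t b : Bool) (c d : Spin m) :
    colStep q Φ α j z₁ z₂ t b V c d =
      match t, b with
      | false, false => V c d * wtEmpty j z₁ c * wtEmpty j z₂ d +
          if c = none ∧ d = some j then V (some j) none * (-(Φ / q) * (1 - q ^ 2) * z₁) else 0
      | true, true => V c d * wtFull q Φ α j z₁ c * wtFull q Φ α j z₂ d +
          if c = some j ∧ d = none then V none (some j) * (-(Φ / q) * (1 - q ^ 2) * z₂) else 0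
      | false, true =>
          (if d = none then V c (some j) * wtEmpty j z₁ c * (-(Φ / q) * (1 - q ^ 2) * z₂)
            else 0) +
          if c = none then V (some j) d * (-(Φ / q) * (1 - q ^ 2) * z₁) * wtFull q Φ α j z₂ d
            else 0
      | true, false => (if c = some j then V none d * wtEmpty j z₂ d else 0) +
          if d = some j then V c none * wtFull q Φ α j z₁ c else 0 := by
  rw [colStep, Fintype.sum_bool]
  cases t <;> cases b <;>
    simp only [rowStep_ff, rowStep_ft, rowStep_tf, rowStep_tt] <;> split_ifs <;>
    simp_all [add_comm]

lemma Exchange.halfExchange_colStep (hq : q ≠ 0) (hz : z₁ ≠ z₂)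
    (hα : ∀ x y, α x y * α y x = 1) (j : ZMod m)
    (h₁ : ∀ a b, a ≠ j → b ≠ j → gt' a b → gt a b) (h₂ : ∀ b, ¬ gt' b j)
    (h₃ : ∀ b, b ≠ j → gt b j) (h : Exchange q Φ α gt z₁ z₂ V W) (t b : Bool) :
    HalfExchange q Φ α gt' z₁ z₂ (colStep q Φ α j z₁ z₂ t b V)
      (colStep q Φ α j z₂ z₁ t b W) := by
  have hz₁ : z₂ - z₁ ≠ 0 := sub_ne_zero.2 hz.symm
  have hz₂ : z₁ - z₂ ≠ 0 := sub_ne_zero.2 hz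
  have hα0 : ∀ x y, α x y ≠ 0 := fun x y => left_ne_zero_of_mul_eq_one (hα x y)
  have hinv : ∀ x y, α x y = (α y x)⁻¹ := fun x y => eq_inv_of_mul_eq_one_left (hα x y)
  obtain ⟨u, hu₁, hu₂⟩ := h.diag j
  constructor
  · intro a
    by_cases ha : a = j
    · subst ha
      have e₁ := h.left.plus a
      have e₂ := h.right.plus a
      simp only [colStep_eq]
      cases t <;> cases b <;> simp [wtEmpty, wtFull, e₁, e₂, hu₁, hu₂, h.plus_plus] <;>
        field_simp <;> ring
    · have e₁ := h.left.plus a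
      have e₃ := h.left.color a j (h₃ a ha)
      have := hα0 (-a) (-j)
      simp only [colStep_eq]
      cases t <;> cases b <;> simp [wtEmpty, wtFull, ha, e₁, e₃, hinv (-j) (-a)] <;>
        field_simp <;> ring
  · intro a b' hab
    have hb : b' ≠ j := fun e => h₂ a (e ▸ hab)
    by_cases ha : a = j
    · subst ha
      have e₁ := h.left.color b' a (h₃ b' hb)
      have e₂ := h.right.color b' a (h₃ b' hb)
      have e₃ := h.left.plus b'
      have e₄ := h.right.plus b'
      have := hα0 (-b') (-a)
      simp only [colStep_eq]
      cases t <;> cases b <;> simp [wtEmpty, wtFull, hb, e₁, e₂, e₃, e₄, hinv (-a) (-b')] <;>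
        field_simp <;> ring
    · have e₁ := h.left.color a b' (h₁ a b' ha hb hab)
      simp only [colStep_eq]
      cases t <;> cases b <;> simp [wtEmpty, wtFull, ha, hb, e₁]
      field_simp

lemma Exchange.colStep (hq : q ≠ 0) (hz : z₁ ≠ z₂)
    (hα : ∀ x y, α x y * α y x = 1) (j : ZMod m)
    (h₁ : ∀ a b, a ≠ j → b ≠ j → gt' a b → gt a b) (h₂ : ∀ b, ¬ gt' b j)
    (h₃ : ∀ b, b ≠ j → gt b j) (h : Exchange q Φ α gt z₁ z₂ V W) (t b : Bool) :
    Exchange q Φ α gt' z₁ z₂ (colStep q Φ α j z₁ z₂ t b V) (colStep q Φ α j z₂ z₁ t b W) := by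
  refine ⟨h.halfExchange_colStep hq hz hα j h₁ h₂ h₃ t b,
    h.symm.halfExchange_colStep hq hz.symm hα j h₁ h₂ h₃ t b, ?_, fun a => ?_⟩
  · have hz₁ : z₂ - z₁ ≠ 0 := sub_ne_zero.2 hz.symm
    have hz₂ : z₁ - z₂ ≠ 0 := sub_ne_zero.2 hz
    simp only [colStep_eq]
    cases t <;> cases b <;>
      simp [wtEmpty, wtFull, h.plus_plus, h.left.plus j, h.right.plus j]
    field_simp
    ring
  · obtain ⟨u, hu₁, hu₂⟩ := h.diag a
    have hz₁ : z₂ - z₁ ≠ 0 := sub_ne_zero.2 hz.symm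
    have hz₂ : z₁ - z₂ ≠ 0 := sub_ne_zero.2 hz
    simp only [colStep_eq]
    cases t <;> cases b
    · exact ⟨u * wtEmpty j z₁ (some a) * wtEmpty j z₂ (some a),
        by simp [hu₁]; ring, by simp [hu₂]; ring⟩
    · exact ⟨0, by simp, by simp⟩
    · by_cases ha : a = j
      · subst ha
        refine ⟨Φ * (z₂ * W (some a) none - z₁ * V (some a) none) / ((z₂ - z₁) * q), ?_, ?_⟩ <;>
          simp [wtEmpty, wtFull, h.left.plus a, h.right.plus a] <;> field_simp <;> ring
      · exact ⟨0, by simp [ha], by simp [ha]⟩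
    · exact ⟨u * wtFull q Φ α j z₁ (some a) * wtFull q Φ α j z₂ (some a),
        by simp [hu₁]; ring, by simp [hu₂]; ring⟩

lemma rep_add_one_lt_rep_add_one {x y : ZMod m} (hx : x ≠ 0) (hy : y ≠ 0)
    (h : rep m x < rep m y) : rep m (x + 1) < rep m (y + 1) := by
  have key : ∀ x : ZMod m, x ≠ 0 → (x - 1).val + 1 = x.val := by
    intro x hx
    have h1 : 1 ≤ x.val := Nat.one_le_iff_ne_zero.2 ((ZMod.val_ne_zero x).2 hx)
    have hm : x.val < m := ZMod.val_lt x
    have : x - 1 = ((x.val - 1 : ℕ) : ZMod m) := by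
      rw [Nat.cast_sub h1, ZMod.natCast_zmod_val, Nat.cast_one]
    rw [this, ZMod.val_natCast, Nat.mod_eq_of_lt (by omega)]
    omega
  rw [rep, rep, key x hx, key y hy] at h
  simpa [rep] using h

lemma rep_le_rep_zero (x : ZMod m) : rep m x ≤ rep m 0 := by
  obtain ⟨n, rfl⟩ := Nat.exists_eq_succ_of_ne_zero (NeZero.ne m)
  have : (-1 : ZMod (n + 1)).val = n := ZMod.val_neg_one n
  have hx := ZMod.val_lt (x - 1)
  simp only [rep, zero_sub, Nat.succ_eq_add_one] at hx ⊢
  omega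

/-- The two-row partition function satisfies the exchange relations with respect to the
order of colors rotated by the number of the rightmost column. -/
lemma pairZ_exchange (hq : q ≠ 0) (hz : z₁ ≠ z₂) (hα : ∀ x y, α x y * α y x = 1)
    (N p : ℕ) (T B : Fin N → Bool) :
    Exchange q Φ α (fun a b => rep m (b + p) < rep m (a + p)) z₁ z₂
      (pairZ q Φ α z₁ z₂ N p T B) (pairZ q Φ α z₂ z₁ N p T B) := by
  induction N generalizing p with
  | zero =>
    refine ⟨⟨?_, ?_⟩, ⟨?_, ?_⟩, ?_, fun a => ⟨0, ?_, ?_⟩⟩ <;> simp [pairZ, rowZ]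
  | succ N ih =>
    have hsucc : ∀ t s : ℂ, pairZ q Φ α t s (N + 1) p T B =
        _root_.colStep q Φ α (colC m p) t s (T 0) (B 0)
          (pairZ q Φ α t s N (p + 1) (Fin.tail T) (Fin.tail B)) :=
      fun t s => funext₂ (pairZ_succ q Φ α t s N p T B)
    rw [hsucc, hsucc]
    have hne : ∀ a : ZMod m, a ≠ colC m p → a + p ≠ 0 :=
      fun a ha h => ha (eq_neg_of_add_eq_zero_left h)
    refine (ih (p + 1) _ _).colStep hq hz hα _ ?_ ?_ ?_ _ _
    · intro a b ha hb hab
      simpa [add_assoc] using rep_add_one_lt_rep_add_one (hne b hb) (hne a ha) hab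
    · intro b
      simpa [colC] using rep_le_rep_zero (b + (p : ZMod m))
    · intro b hb
      have : 0 < (b + p).val := Nat.pos_of_ne_zero ((ZMod.val_ne_zero _).2 (hne b hb))
      simpa [colC, rep, ← add_assoc] using this

end Exchange

section PartitionFunction

lemma sum_eq_sum_of_sum_update_eq {ι X : Type*} [Fintype ι] [DecidableEq ι] [Fintype X]
    (p : ι) (f g : (ι → X) → ℂ)
    (h : ∀ v, ∑ x, f (Function.update v p x) = ∑ x, g (Function.update v p x)) :
    ∑ v, f v = ∑ v, g v := by
  rcases isEmpty_or_nonempty X with hX | ⟨⟨x₀⟩⟩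
  · have : IsEmpty (ι → X) := ⟨fun v => hX.elim (v p)⟩
    simp
  · rw [← (Equiv.funSplitAt p X).symm.sum_comp, ← (Equiv.funSplitAt p X).symm.sum_comp g,
      Fintype.sum_prod_type_right, Fintype.sum_prod_type_right]
    refine Finset.sum_congr rfl fun u _ => ?_
    have key : ∀ x, (Equiv.funSplitAt p X).symm (x, u) =
        Function.update ((Equiv.funSplitAt p X).symm (x₀, u)) p x := by
      intro x
      ext k
      by_cases hk : k = p
      · subst hk; simp
      · simp [hk]
    simpa only [← key] using h ((Equiv.funSplitAt p X).symm (x₀, u))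

variable {m : ℕ} [NeZero m] {r N : ℕ} {q Φ : ℂ} {α : ZMod m → ZMod m → ℂ}

open Classical in
lemma Z_eq_sum_prod_rowZ (μ : Fin r → ℕ) (σ : Fin r → ZMod m) (z : Fin r → ℂ) :
    Z m r N q Φ α μ σ z = ∑ v : Fin (r + 1) → Fin N → Bool,
      if (∀ k : Fin N, v 0 k = true ↔ ∃ i, μ i = (k : ℕ)) ∧ (∀ k, v (Fin.last r) k = false) then
        ∏ i : Fin r, rowZ q Φ α (z i) N 0 (v i.castSucc) (v i.succ) (some (σ i)) else 0 := by
  rw [Z, Fintype.sum_prod_type_right]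
  refine Finset.sum_congr rfl fun v _ => ?_
  split_ifs with hv
  · simp only [rowZ_eq_sum]
    rw [Finset.prod_univ_sum, Fintype.piFinset_univ]
    refine Finset.sum_congr rfl fun h _ => ?_
    rw [Finset.prod_ite_zero]
    by_cases hh : ∀ i ∈ Finset.univ, h i (Fin.last N) = none ∧ h i 0 = some (σ i)
    · rw [if_pos hh]
      simp only [Finset.mem_univ, true_implies] at hh
      have hswt : swt q Φ α z (h, v) = ∏ i, ∏ k : Fin N, wt m q Φ α (colC m (0 + k)) (z i)
          (h i k.succ) (edgeSpin (colC m (0 + k)) (v i.castSucc k)) (h i k.castSucc)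
          (edgeSpin (colC m (0 + k)) (v i.succ k)) := by
        simp [swt, vspin, edgeSpin]
      rw [← hswt]
      refine ite_eq_left_iff.2 fun hs => ?_
      obtain ⟨i, k, hik⟩ : ∃ (i : Fin r) (k : Fin N), ¬ Adm m (colC m k) (h i k.succ)
          (vspin (h, v) i.castSucc k) (h i k.castSucc) (vspin (h, v) i.succ k) := by
        by_contra! hc
        exact hs ⟨fun i => (hh i).1, fun i => (hh i).2, hv.1, hv.2, hc⟩
      exact (Finset.prod_eq_zero (Finset.mem_univ i)
        (Finset.prod_eq_zero (Finset.mem_univ k) (wt_eq_zero_of_not_adm hik))).symm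
    · rw [if_neg hh, if_neg]
      exact fun hs => hh fun i _ => ⟨hs.1 i, hs.2.1 i⟩
  · exact Finset.sum_eq_zero fun h _ => if_neg fun hs => hv ⟨hs.2.2.1, hs.2.2.2.1⟩

lemma idx0_ne_idx1 (i : AIdx r) : idx0 i ≠ idx1 i := by
  simp [idx0, idx1, Fin.ext_iff]

/-- The contribution of the rows different from `i` and `i + 1`. -/
def outerZ (q Φ : ℂ) (α : ZMod m → ZMod m → ℂ) (i : AIdx r) (σ : Fin r → ZMod m)
    (z : Fin r → ℂ) (v : Fin (r + 1) → Fin N → Bool) : ℂ :=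
  ∏ k ∈ (Finset.univ.erase (idx0 i)).erase (idx1 i),
    rowZ q Φ α (z k) N 0 (v k.castSucc) (v k.succ) (some (σ k))

lemma outerZ_comp_sw_left (i : AIdx r) (σ : Fin r → ZMod m) (z : Fin r → ℂ)
    (v : Fin (r + 1) → Fin N → Bool) :
    outerZ q Φ α i (σ ∘ sw i) z v = outerZ q Φ α i σ z v := by
  refine Finset.prod_congr rfl fun k hk => ?_
  simp only [Finset.mem_erase] at hk
  simp [sw, Equiv.swap_apply_of_ne_of_ne hk.2.1 hk.1]

lemma outerZ_comp_sw_right (i : AIdx r) (σ : Fin r → ZMod m) (z : Fin r → ℂ)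
    (v : Fin (r + 1) → Fin N → Bool) :
    outerZ q Φ α i σ (z ∘ sw i) v = outerZ q Φ α i σ z v := by
  refine Finset.prod_congr rfl fun k hk => ?_
  simp only [Finset.mem_erase] at hk
  simp [sw, Equiv.swap_apply_of_ne_of_ne hk.2.1 hk.1]

lemma sum_update_prod_rowZ (i : AIdx r) (σ : Fin r → ZMod m) (z : Fin r → ℂ)
    (v : Fin (r + 1) → Fin N → Bool) :
    ∑ x, ∏ k : Fin r, rowZ q Φ α (z k) N 0 (Function.update v (idx0 i).succ x k.castSucc)
        (Function.update v (idx0 i).succ x k.succ) (some (σ k)) =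
      outerZ q Φ α i σ z v * pairZ q Φ α (z (idx0 i)) (z (idx1 i)) N 0
        (v (idx0 i).castSucc) (v (idx1 i).succ) (some (σ (idx0 i))) (some (σ (idx1 i))) := by
  rw [pairZ, Finset.mul_sum]
  refine Finset.sum_congr rfl fun x _ => ?_
  have hmem : idx1 i ∈ Finset.univ.erase (idx0 i) := by simp [(idx0_ne_idx1 i).symm]
  rw [← Finset.mul_prod_erase _ _ (Finset.mem_univ (idx0 i)), ← Finset.mul_prod_erase _ _ hmem]
  have h₁ : (idx1 i).castSucc = (idx0 i).succ := by simp [idx0, idx1]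
  have h₂ : (idx0 i).castSucc ≠ (idx0 i).succ := by simp [idx0, Fin.ext_iff]
  have h₃ : (idx1 i).succ ≠ (idx0 i).succ := by simp [idx0, idx1, Fin.ext_iff]
  have hout : ∏ k ∈ (Finset.univ.erase (idx0 i)).erase (idx1 i),
      rowZ q Φ α (z k) N 0 (Function.update v (idx0 i).succ x k.castSucc)
        (Function.update v (idx0 i).succ x k.succ) (some (σ k)) = outerZ q Φ α i σ z v := by
    refine Finset.prod_congr rfl fun k hk => ?_
    simp only [Finset.mem_erase] at hk
    have h₄ : k.castSucc ≠ (idx0 i).succ := fun h =>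
      hk.1 (Fin.castSucc_injective _ (h.trans h₁.symm))
    have h₅ : k.succ ≠ (idx0 i).succ := fun h => hk.2.1 (Fin.succ_injective _ h)
    rw [Function.update_of_ne h₄, Function.update_of_ne h₅]
  rw [hout, h₁, Function.update_self, Function.update_of_ne h₂, Function.update_of_ne h₃]
  ring

lemma Z_comp_sw (hq : q ≠ 0) (hα : ∀ x y, α x y * α y x = 1) (μ : Fin r → ℕ)
    (σ : Fin r → ZMod m) (i : AIdx r) (hσ : rep m (σ (idx1 i)) < rep m (σ (idx0 i)))
    (z : Fin r → ℂ) (hz : Function.Injective z) :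
    Z m r N q Φ α μ (σ ∘ sw i) z =
      alphaT m q α σ (idx0 i) (idx1 i) * DemT q i (Z m r N q Φ α μ σ) z := by
  classical
  have hne : z (idx0 i) ≠ z (idx1 i) := fun h => idx0_ne_idx1 i (hz h)
  have hne' : z (idx1 i) - z (idx0 i) ≠ 0 := sub_ne_zero.2 hne.symm
  simp only [DemT, Z_eq_sum_prod_rowZ, mul_add, Finset.mul_sum, ← Finset.sum_add_distrib]
  refine sum_eq_sum_of_sum_update_eq (idx0 i).succ _ _ fun v => ?_
  have h₁ : (0 : Fin (r + 1)) ≠ (idx0 i).succ := (Fin.succ_ne_zero _).symm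
  have h₂ : Fin.last r ≠ (idx0 i).succ := by
    have := i.2
    simp [idx0, Fin.ext_iff]
    omega
  simp only [Function.update_of_ne h₁, Function.update_of_ne h₂]
  split_ifs with hv
  · simp only [Finset.sum_add_distrib, ← Finset.mul_sum, sum_update_prod_rowZ,
      outerZ_comp_sw_left, outerZ_comp_sw_right]
    have key := (pairZ_exchange (Φ := Φ) hq hne hα N 0 (v (idx0 i).castSucc)
      (v (idx1 i).succ)).left.color (σ (idx0 i)) (σ (idx1 i)) (by simpa using hσ)
    simp only [sw, Function.comp_apply, Equiv.swap_apply_left, Equiv.swap_apply_right, key,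
      alphaT, eps, if_pos hσ, zpow_one]
    field_simp
  · simp

end PartitionFunction
section Words

variable {r : ℕ}

/-- The number of pairs of positions at which `f` increases. -/
def ascCount (f : Fin r → ℕ) : ℕ :=
  (Finset.univ.filter fun p : Fin r × Fin r => p.1 < p.2 ∧ f p.1 < f p.2).card

lemma idx0_lt_idx1 (i : AIdx r) : idx0 i < idx1 i := by
  simp [idx0, idx1]

lemma sw_sw (i : AIdx r) (k : Fin r) : sw i (sw i k) = k := Equiv.swap_apply_self _ _ _

lemma sw_lt_sw {i : AIdx r} {a b : Fin r} (h : a < b) (hab : ¬ (a = idx0 i ∧ b = idx1 i)) :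
    sw i a < sw i b := by
  simp only [sw, Equiv.swap_apply_def]
  have h0 : (idx0 i).val = i.1 := rfl
  have h1 : (idx1 i).val = i.1 + 1 := rfl
  simp only [Fin.ext_iff, Fin.lt_def] at *
  split_ifs <;> omega

lemma ascCount_comp_sw_add_one {f : Fin r → ℕ} {i : AIdx r} (h : f (idx0 i) < f (idx1 i)) :
    ascCount (f ∘ sw i) + 1 = ascCount f := by
  have hmem : (idx0 i, idx1 i) ∈ Finset.univ.filter
      fun p : Fin r × Fin r => p.1 < p.2 ∧ f p.1 < f p.2 := by
    simp [h, idx0_lt_idx1]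
  rw [ascCount, ascCount, ← Finset.card_erase_add_one hmem, add_left_inj]
  have h₀ : sw i (idx0 i) = idx1 i := Equiv.swap_apply_left _ _
  have h₁ : sw i (idx1 i) = idx0 i := Equiv.swap_apply_right _ _
  refine Finset.card_nbij' (fun p => (sw i p.1, sw i p.2)) (fun p => (sw i p.1, sw i p.2))
    ?_ ?_ (fun p _ => by simp [sw_sw]) (fun p _ => by simp [sw_sw])
  · rintro ⟨a, b⟩ hp
    simp only [Finset.coe_filter, Finset.mem_univ, true_and, Set.mem_ofPred_eq,
      Function.comp_apply] at hp
    have hab : ¬ (a = idx0 i ∧ b = idx1 i) := by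
      rintro ⟨rfl, rfl⟩
      rw [h₀, h₁] at hp
      omega
    have hne : ¬ (sw i a = idx0 i ∧ sw i b = idx1 i) := by
      rintro ⟨ha, hb⟩
      have ha' := congrArg (sw i) ha
      have hb' := congrArg (sw i) hb
      rw [sw_sw] at ha' hb'
      rw [ha', hb', h₀, h₁] at hp
      exact absurd (idx0_lt_idx1 i) hp.1.asymm
    simp [hp.2, sw_lt_sw hp.1 hab, hne]
  · rintro ⟨a, b⟩ hp
    simp only [Finset.coe_erase, Finset.coe_filter, Finset.mem_univ, true_and, Set.mem_sdiff,
      Set.mem_ofPred_eq, Set.mem_singleton_iff, Prod.mk.injEq] at hp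
    simp [sw_sw, hp.1.2, sw_lt_sw hp.1.1 hp.2]

lemma comp_sw_comp_sw {X : Type*} (f : Fin r → X) (i : AIdx r) : (f ∘ sw i) ∘ sw i = f :=
  funext fun k => congrArg f (sw_sw i k)

lemma ascCount_comp_sw_of_gt {f : Fin r → ℕ} {i : AIdx r} (h : f (idx1 i) < f (idx0 i)) :
    ascCount (f ∘ sw i) = ascCount f + 1 := by
  have := ascCount_comp_sw_add_one (f := f ∘ sw i) (i := i) (by simpa [sw] using h)
  rw [comp_sw_comp_sw] at this
  exact this.symm

lemma ascCount_comp_sw_of_le {f : Fin r → ℕ} {i : AIdx r} (h : f (idx0 i) ≤ f (idx1 i)) :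
    ascCount (f ∘ sw i) ≤ ascCount f := by
  rcases h.lt_or_eq with h | h
  · exact (ascCount_comp_sw_add_one h) ▸ Nat.le_succ _
  · refine le_of_eq (congrArg ascCount (funext fun k => ?_))
    simp only [Function.comp_apply, sw, Equiv.swap_apply_def]
    split_ifs <;> simp_all

lemma ascCount_eq_zero {f : Fin r → ℕ} (h : Antitone f) : ascCount f = 0 := by
  rw [ascCount, Finset.card_eq_zero, Finset.filter_eq_empty_iff]
  exact fun p _ hp => (h hp.1.le).not_gt hp.2

lemma pact_one {X : Type*} (f : Fin r → X) : pact 1 f = f := rfl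

lemma pact_wordProd_cons {X : Type*} (i : AIdx r) (L : List (AIdx r)) (f : Fin r → X) :
    pact (wordProd (i :: L)) f = pact (wordProd L) f ∘ sw i := by
  ext k
  simp [pact, wordProd, sw]

lemma ascCount_pact_wordProd_le (L : List (AIdx r)) (f : Fin r → ℕ) :
    ascCount (pact (wordProd L) f) ≤ ascCount f + L.length := by
  induction L with
  | nil => simp [pact_one, wordProd]
  | cons i L ih =>
    rw [pact_wordProd_cons, List.length_cons]
    rcases le_or_gt (pact (wordProd L) f (idx0 i)) (pact (wordProd L) f (idx1 i)) with h | h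
    · have := ascCount_comp_sw_of_le h
      omega
    · have := ascCount_comp_sw_of_gt h
      omega

lemma invCount_eq_ascCount (w : Equiv.Perm (Fin r)) :
    invCount w = ascCount (pact w fun k => r - (k : ℕ)) := by
  refine Finset.card_nbij' (fun p => (w p.2, w p.1)) (fun p => (w⁻¹ p.2, w⁻¹ p.1))
    ?_ ?_ (fun p _ => by simp) (fun p _ => by simp) <;>
  · rintro ⟨a, b⟩ hp
    simp only [pact, Finset.coe_filter, Finset.mem_univ, true_and, Set.mem_ofPred_eq,
      Fin.lt_def, Equiv.Perm.coe_inv, Equiv.symm_apply_apply, Equiv.apply_symm_apply] at hp ⊢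
    omega

lemma invCount_wordProd_le (L : List (AIdx r)) : invCount (wordProd L) ≤ L.length := by
  rw [invCount_eq_ascCount]
  refine (ascCount_pact_wordProd_le L _).trans ?_
  rw [ascCount_eq_zero, zero_add]
  exact fun a b hab => Nat.sub_le_sub_left hab r

lemma exists_ascent_of_not_antitone {f : Fin r → ℕ} (h : ¬ Antitone f) :
    ∃ i : AIdx r, f (idx0 i) < f (idx1 i) := by
  cases r with
  | zero => exact absurd (fun a => a.elim0) h
  | succ n =>
    rw [Fin.antitone_iff_succ_le] at h
    push Not at h
    obtain ⟨k, hk⟩ := h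
    exact ⟨⟨k, Nat.succ_lt_succ k.2⟩, hk⟩

/-- Every rearrangement of a weakly decreasing sequence is obtained from it by a word whose
length is the number of ascents. -/
lemma exists_word_of_antitone {g : Fin r → ℕ} (hg : Antitone g) (w : Equiv.Perm (Fin r)) :
    ∃ L : List (AIdx r), pact (wordProd L) g = pact w g ∧ L.length = ascCount (pact w g) := by
  induction hn : ascCount (pact w g) generalizing w with
  | zero =>
    have hanti : Antitone (pact w g) := by
      by_contra h
      obtain ⟨i, hi⟩ := exists_ascent_of_not_antitone h
      have := ascCount_comp_sw_add_one hi
      omega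
    refine ⟨[], ?_, rfl⟩
    have := Tuple.unique_monotone (f := OrderDual.toDual ∘ g) (σ := 1) (τ := w⁻¹)
      hg.dual_right hanti.dual_right
    exact funext fun k => congrFun this k
  | succ n ih =>
    obtain ⟨i, hi⟩ : ∃ i : AIdx r, pact w g (idx0 i) < pact w g (idx1 i) := by
      refine exists_ascent_of_not_antitone fun h => ?_
      rw [ascCount_eq_zero h] at hn
      omega
    have hsw : pact (sw i * w) g = pact w g ∘ sw i := by
      ext k
      simp [pact, sw]
    have := ascCount_comp_sw_add_one hi
    obtain ⟨L, hL, hlen⟩ := ih (sw i * w) (by rw [hsw]; omega)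
    refine ⟨i :: L, ?_, by simp [hlen]⟩
    rw [pact_wordProd_cons, hL, hsw, comp_sw_comp_sw]

lemma rep_injective (m : ℕ) [NeZero m] : Function.Injective (rep m) := fun _ _ h =>
  sub_left_injective (ZMod.val_injective m (Nat.succ_injective h))

end Words

lemma Z_wordProd {m : ℕ} [NeZero m] {r N : ℕ} {q Φ : ℂ} {α : ZMod m → ZMod m → ℂ}
    (hq : q ≠ 0) (hα : ∀ x y, α x y * α y x = 1) (μ : Fin r → ℕ) (σ : Fin r → ZMod m)
    (hσ : Antitone (rep m ∘ σ)) (L : List (AIdx r))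
    (hL : L.length ≤ ascCount (rep m ∘ pact (wordProd L) σ))
    (z : Fin r → ℂ) (hz : Function.Injective z) :
    Z m r N q Φ α μ (pact (wordProd L) σ) z =
      alphaTWord m q α L σ * DemTWord q L (Z m r N q Φ α μ σ) z := by
  induction L generalizing z with
  | nil => simp [pact_one, wordProd, alphaTWord, DemTWord]
  | cons i L ih =>
    have hle := ascCount_pact_wordProd_le L (rep m ∘ σ)
    rw [ascCount_eq_zero hσ, zero_add] at hle
    change ascCount (rep m ∘ pact (wordProd L) σ) ≤ _ at hle
    rw [pact_wordProd_cons, List.length_cons, ← Function.comp_assoc] at hL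
    have hgt : rep m (pact (wordProd L) σ (idx1 i)) < rep m (pact (wordProd L) σ (idx0 i)) := by
      by_contra! h
      have := ascCount_comp_sw_of_le (f := rep m ∘ pact (wordProd L) σ) (i := i) h
      omega
    have hasc := ascCount_comp_sw_of_gt (f := rep m ∘ pact (wordProd L) σ) (i := i) hgt
    have ih' := ih (by omega)
    rw [pact_wordProd_cons, Z_comp_sw hq hα μ _ i hgt z hz]
    simp only [DemT, ih' z hz, ih' (z ∘ sw i) (hz.comp (sw i).injective), alphaTWord, DemTWord]
    ring

/-- σ-orbit recursion: let `σ̂` be the weakly decreasing rearrangement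
of `σ` and `w` the minimal-length permutation with `σ = wσ̂`.  Then for every reduced
expression `w = s_{i_1} ⋯ s_{i_k}`,
`Z(𝔖^m_{μ,σ}) = α̃_w(σ̂) · T_{i_1} ⋯ T_{i_k} · Z(𝔖^m_{μ,σ̂})`
(an identity of rational functions of `z`, stated at all points `z` with
nonzero, pairwise distinct coordinates). -/
theorem sigma_orbit_recursion
    (m : ℕ) [NeZero m] (r N : ℕ) (q Φ : ℂ) (hq : q ≠ 0) (hΦ : Φ ≠ 0)
    (α : ZMod m → ZMod m → ℂ) (hα : ∀ x y, α x y * α y x = 1) (hα1 : ∀ x, α x x = 1)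
    (μ : Fin r → ℕ) (hμ : StrictAnti μ) (hμN : ∀ i, μ i < N)
    (σ σhat : Fin r → ZMod m)
    (hanti : ∀ i j : Fin r, i ≤ j → rep m (σhat j) ≤ rep m (σhat i))
    (w : Equiv.Perm (Fin r))
    (hw : ∀ i, σ i = σhat (w⁻¹ i))
    (hmin : ∀ u : Equiv.Perm (Fin r), (∀ i, σ i = σhat (u⁻¹ i)) → invCount w ≤ invCount u)
    (L : List (AIdx r)) (hL : wordProd L = w) (hLred : L.length = invCount w)
    (z : Fin r → ℂ) (hz : ∀ i, z i ≠ 0) (hzinj : Function.Injective z) :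
    Z m r N q Φ α μ σ z =
      alphaTWord m q α L σhat * DemTWord q L (Z m r N q Φ α μ σhat) z := by
  have hσ : σ = pact w σhat := funext hw
  have hanti' : Antitone (rep m ∘ σhat) := fun i j hij => hanti i j hij
  obtain ⟨L', hL', hlen⟩ := exists_word_of_antitone hanti' w
  have hu : ∀ i, σ i = σhat ((wordProd L')⁻¹ i) := fun i =>
    rep_injective m ((congrArg (rep m) (hw i)).trans (congrFun hL' i).symm)
  have hbound : L.length ≤ ascCount (rep m ∘ pact w σhat) :=
    hLred.trans_le ((hmin _ hu).trans ((invCount_wordProd_le L').trans hlen.le))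
  subst hL
  rw [hσ]
  exact Z_wordProd hq hα μ σhat hanti' L hbound z hzinj
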